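/- Let (Ω, 𝒫) be a probability space, E and F real normed vector spaces, β < 0 a real number, and f : E → F a function that is (Fréchet) differentiable at 0. Let X(t), t ≥ 1, be an E-valued random sequence belonging to class 𝒞(β). Then the sequence f(X(t)) − f(0) belongs to class 𝒞(β), i.e., for every ε > 0, almost surely ‖f(X(t)) − f(0)‖ / t^{β+ε} → 0 as t → ∞. -/

import Mathlib

open Filter MeasureTheory
open scoped Topology

/-- A sequence of random elements `X(t)` with values in a normed space belongs to class
`𝒞(β)` if for every `ε > 0`, almost surely `‖X(t)‖ / t^{β+ε} → 0` as `t → ∞`. -/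
def MemClassC {Ω : Type*} [MeasurableSpace Ω] (μ : MeasureTheory.Measure Ω)
    {E : Type*} [NormedAddCommGroup E] (X : ℕ → Ω → E) (β : ℝ) : Prop :=
  ∀ ε > (0:ℝ), ∀ᵐ ω ∂μ,
    Tendsto (fun t : ℕ => ‖X t ω‖ / (t : ℝ) ^ (β + ε)) atTop (𝓝 0)

/-- Part 2 of Lemma 1 of the paper: if `f` is (Fréchet) differentiable at `0`, `β < 0`, and
`X ∈ 𝒞(β)`, then `f(X(t)) − f(0) ∈ 𝒞(β)`. -/
theorem memClassC_comp_differentiableAt {Ω : Type*} [MeasurableSpace Ω]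
    (μ : MeasureTheory.Measure Ω) [IsProbabilityMeasure μ]
    {E F : Type*} [NormedAddCommGroup E] [NormedSpace ℝ E]
    [NormedAddCommGroup F] [NormedSpace ℝ F]
    (f : E → F) (hf : DifferentiableAt ℝ f 0)
    (β : ℝ) (hβ : β < 0)
    (X : ℕ → Ω → E) (hX : MemClassC μ X β) :
    MemClassC μ (fun t ω => f (X t ω) - f 0) β := by
  intro ε hε
  filter_upwards [hX ε hε, hX (-β) (neg_pos.mpr hβ)] with ω hω hω₀
  have hX₀ : Tendsto (fun t => X t ω) atTop (𝓝 0) := by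
    simpa [← tendsto_zero_iff_norm_tendsto_zero] using hω₀
  have hO : (fun t => f (X t ω) - f 0) =O[atTop] fun t => X t ω := by
    simpa [Function.comp_def] using hf.isBigO_sub.comp_tendsto hX₀
  have hdiv := hO.norm_norm.mul
    (Asymptotics.isBigO_refl (fun t : ℕ => ((t : ℝ) ^ (β + ε))⁻¹) atTop)
  simp only [← div_eq_mul_inv] at hdiv
  exact hdiv.trans_tendsto hω
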